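/- Let δ ∈ (0, 1), set λ₁ = (δ + √δ)/2 and z₁ = (λ₁ + δ/λ₁)/2. Then δ < λ₁ < √δ < 1, 0 < z₁ λ₁ < 1 and λ₁ < z₁, and the real symmetric 2 × 2 matrix P with P₁₁ = P₂₂ = (1 − z₁²)/(1 − λ₁²) and P₁₂ = P₂₁ = (1 + z₁²)/(1 + λ₁²) satisfies det P < 0; in particular P is not positive semidefinite. -/

import Mathlib

noncomputable section

theorem statement18 (δ : ℝ) (hδ : δ ∈ Set.Ioo (0 : ℝ) 1)
    (lam1 z1 : ℝ) (hlam1 : lam1 = (δ + Real.sqrt δ) / 2)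
    (hz1 : z1 = (lam1 + δ / lam1) / 2)
    (P : Matrix (Fin 2) (Fin 2) ℝ)
    (hP : P = !![(1 - z1 ^ 2) / (1 - lam1 ^ 2), (1 + z1 ^ 2) / (1 + lam1 ^ 2);
                 (1 + z1 ^ 2) / (1 + lam1 ^ 2), (1 - z1 ^ 2) / (1 - lam1 ^ 2)]) :
    δ < lam1 ∧ lam1 < Real.sqrt δ ∧ Real.sqrt δ < 1 ∧
      0 < z1 * lam1 ∧ z1 * lam1 < 1 ∧ lam1 < z1 ∧
      P.det < 0 ∧ ¬ P.PosSemidef := by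
  obtain ⟨h0, h1⟩ := hδ
  have hs0 : 0 < Real.sqrt δ := Real.sqrt_pos.mpr h0
  have hss : Real.sqrt δ * Real.sqrt δ = δ := Real.mul_self_sqrt h0.le
  have hs1 : Real.sqrt δ < 1 := by nlinarith
  have hds : δ < Real.sqrt δ := by nlinarith
  have a1 : δ < lam1 := by linarith
  have a2 : lam1 < Real.sqrt δ := by linarith
  have l0 : 0 < lam1 := by linarith
  have hl2 : lam1 ^ 2 < δ := by nlinarith
  have hzl : z1 * lam1 = (lam1 ^ 2 + δ) / 2 := by
    rw [hz1]; field_simp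
  have b1 : 0 < z1 * lam1 := by rw [hzl]; positivity
  have b2 : z1 * lam1 < 1 := by linarith
  have b3 : lam1 < z1 := by
    by_contra h
    push Not at h
    nlinarith
  have hm : 0 < 1 - lam1 ^ 2 := by linarith
  have hp : 0 < 1 + lam1 ^ 2 := by positivity
  have hsub : (1 - z1 ^ 2) / (1 - lam1 ^ 2) < (1 + z1 ^ 2) / (1 + lam1 ^ 2) := by
    rw [div_lt_div_iff₀ hm hp]
    nlinarith
  have hadd : 0 < (1 - z1 ^ 2) / (1 - lam1 ^ 2) + (1 + z1 ^ 2) / (1 + lam1 ^ 2) := by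
    rw [div_add_div _ _ (ne_of_gt hm) (ne_of_gt hp)]
    apply div_pos _ (mul_pos hm hp)
    have : (z1 * lam1) ^ 2 < 1 := by nlinarith
    nlinarith
  have hdet : P.det < 0 := by
    rw [hP, Matrix.det_fin_two_of]
    nlinarith
  exact ⟨a1, a2, hs1, b1, b2, b3, hdet, fun h => absurd h.det_nonneg (not_le.mpr hdet)⟩
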